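/- The evaluation map f ↦ f(v^⊗) is a k-linear isomorphism from the space Hom_{GL_r(k)}(G(v), (k^r)^{⊗n}) of linear maps G(v) → (k^r)^{⊗n} commuting with the diagonal GL_r(k)-actions onto 𝔖(v), and it intertwines the S_n-actions, where S_n acts on this Hom-space by post-composition, (σ·f)(x) = σ·(f(x)). Likewise, the evaluation map f ↦ f(v^⊗) is a k-linear isomorphism from the space Hom_{S_n}(𝔖(v), (k^r)^{⊗n}) of linear maps commuting with the S_n-actions onto G(v), and it intertwines the GL_r(k)-actions given by post-composition. (The tensor module G(v) is Schur–Weyl dual to 𝔖(v).) -/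

import Mathlib

noncomputable section

/-- The diagonal action of a matrix `g` on `(k^r)^{⊗n}`. -/
def diagAct (k : Type*) [Field k] {r n : ℕ} (g : Matrix (Fin r) (Fin r) k) :
    (PiTensorProduct k fun _ : Fin n => Fin r → k) →ₗ[k]
      (PiTensorProduct k fun _ : Fin n => Fin r → k) :=
  PiTensorProduct.map fun _ => g.mulVecLin

/-- The action of a permutation `σ ∈ S_n` on `(k^r)^{⊗n}` by permuting tensor
factors. -/
def permAct (k : Type*) [Field k] {r n : ℕ} (σ : Equiv.Perm (Fin n)) :
    (PiTensorProduct k fun _ : Fin n => Fin r → k) →ₗ[k]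
      (PiTensorProduct k fun _ : Fin n => Fin r → k) :=
  (PiTensorProduct.reindex k (fun _ : Fin n => Fin r → k) σ).toLinearMap

/-- The decomposable tensor `v₁ ⊗ ⋯ ⊗ v_n` of the columns of `v`. -/
def vtens (k : Type*) [Field k] {r n : ℕ} (v : Matrix (Fin r) (Fin n) k) :
    PiTensorProduct k fun _ : Fin n => Fin r → k :=
  PiTensorProduct.tprod k fun j => fun i => v i j

/-- The tensor module `G(v)`. -/
def tensMod (k : Type*) [Field k] {r n : ℕ} (v : Matrix (Fin r) (Fin n) k) :
    Submodule k (PiTensorProduct k fun _ : Fin n => Fin r → k) :=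
  Submodule.span k {x | ∃ g : (Matrix (Fin r) (Fin r) k)ˣ, x = diagAct k g.1 (vtens k v)}

/-- The module `𝔖(v)`. -/
def symMod (k : Type*) [Field k] {r n : ℕ} (v : Matrix (Fin r) (Fin n) k) :
    Submodule k (PiTensorProduct k fun _ : Fin n => Fin r → k) :=
  Submodule.span k {x | ∃ σ : Equiv.Perm (Fin n), x = permAct k σ (vtens k v)}

/-- The space `Hom_{GL_r(k)}(G(v), (k^r)^{⊗n})` of linear maps commuting with the
diagonal `GL_r(k)`-actions, as a `k`-submodule of the space of all linear maps. -/
def homGL (k : Type*) [Field k] {r n : ℕ} (v : Matrix (Fin r) (Fin n) k) :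
    Submodule k (↥(tensMod k v) →ₗ[k] (PiTensorProduct k fun _ : Fin n => Fin r → k)) where
  carrier := {f | ∀ g : (Matrix (Fin r) (Fin r) k)ˣ, ∀ x y : ↥(tensMod k v),
    y.1 = diagAct k g.1 x.1 → f y = diagAct k g.1 (f x)}
  add_mem' := by
    intro f f' hf hf' g x y hxy
    simp only [LinearMap.add_apply, hf g x y hxy, hf' g x y hxy, map_add]
  zero_mem' := by
    intro g x y hxy; simp
  smul_mem' := by
    intro c f hf g x y hxy
    simp only [LinearMap.smul_apply, hf g x y hxy, map_smul]

/-- The space `Hom_{S_n}(𝔖(v), (k^r)^{⊗n})` of linear maps commuting with the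
`S_n`-actions. -/
def homSn (k : Type*) [Field k] {r n : ℕ} (v : Matrix (Fin r) (Fin n) k) :
    Submodule k (↥(symMod k v) →ₗ[k] (PiTensorProduct k fun _ : Fin n => Fin r → k)) where
  carrier := {f | ∀ σ : Equiv.Perm (Fin n), ∀ x y : ↥(symMod k v),
    y.1 = permAct k σ x.1 → f y = permAct k σ (f x)}
  add_mem' := by
    intro f f' hf hf' σ x y hxy
    simp only [LinearMap.add_apply, hf σ x y hxy, hf' σ x y hxy, map_add]
  zero_mem' := by
    intro σ x y hxy; simp
  smul_mem' := by
    intro c f hf σ x y hxy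
    simp only [LinearMap.smul_apply, hf σ x y hxy, map_smul]

/-- If `N` is multilinear and `N (x + t y, …, x + t y)` lies in a subspace for infinitely many
scalars `t`, then so does `N (x, …, x)`. -/
theorem MultilinearMap.apply_const_mem_of_infinite {k V W ι : Type*} [Field k] [Fintype ι]
    [AddCommMonoid V] [Module k V] [AddCommMonoid W] [Module k W]
    (N : MultilinearMap k (fun _ : ι => V) W) (P : Submodule k W) (x y : V) {S : Set k}
    (hS : S.Infinite) (h : ∀ t ∈ S, N (fun _ => x + t • y) ∈ P) : N (fun _ => x) ∈ P := by
  classical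
  let _ : AddCommGroup W := Module.addCommMonoidToAddCommGroup k
  by_contra hx
  obtain ⟨l, hl, hP⟩ := P.exists_le_ker_of_notMem hx
  let p : Polynomial k := ∑ s : Finset ι,
    Polynomial.C (l (N (s.piecewise (fun _ => y) fun _ => x))) * Polynomial.X ^ s.card
  have hp (t : k) : p.eval t = l (N fun _ => x + t • y) := by
    have e : (fun _ : ι => x + t • y) = (fun _ => t • y) + fun _ => x := by
      ext; simp [add_comm]
    rw [e, N.map_add_univ, _root_.map_sum]
    simp only [p, Polynomial.eval_finsetSum, Polynomial.eval_mul, Polynomial.eval_C,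
      Polynomial.eval_pow, Polynomial.eval_X]
    refine Finset.sum_congr rfl fun s _ => ?_
    have e2 : s.piecewise (fun _ => t • y) (fun _ => x) =
        s.piecewise (fun i => (fun _ : ι => t) i • s.piecewise (fun _ => y) (fun _ => x) i)
          (s.piecewise (fun _ => y) fun _ => x) := by
      ext i
      by_cases hi : i ∈ s <;> simp [hi]
    rw [e2, N.map_piecewise_smul]
    simp [mul_comm]
  have hp0 : p = 0 := by
    refine Polynomial.eq_zero_of_infinite_isRoot p (hS.mono fun t ht => ?_)
    simpa [Polynomial.IsRoot, hp] using hP (h t ht)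
  apply hl
  simpa [hp0] using (hp 0).symm

/-- The alternating sum over the supersets of a proper subset of a finite type vanishes. -/
theorem Finset.sum_superset_neg_one_pow_card {ι : Type*} [Fintype ι] [DecidableEq ι]
    (R : Finset ι) (hR : R ≠ Finset.univ) :
    ∑ S : Finset ι, (if R ⊆ S then (-1 : ℤ) ^ S.card else 0) = 0 := by
  obtain ⟨a, ha⟩ : ∃ a, a ∉ R := by
    by_contra! h
    exact hR (Finset.eq_univ_of_forall h)
  refine Finset.sum_involution (fun S _ => symmDiff S {a}) ?_ ?_ (by simp) (by simp)
  · intro S _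
    by_cases haS : a ∈ S
    · have e : symmDiff S {a} = S.erase a := by
        ext b; by_cases hb : b = a <;> simp [Finset.mem_symmDiff, hb, haS]
      have hc := Finset.card_erase_add_one haS
      have hi : R ⊆ S.erase a ↔ R ⊆ S := by
        rw [Finset.subset_erase]; simp [ha]
      rw [e, ← hc]
      simp only [hi]
      split_ifs <;> ring
    · have e : symmDiff S {a} = insert a S := by
        ext b; by_cases hb : b = a <;> simp [Finset.mem_symmDiff, hb, haS]
      have hi : R ⊆ insert a S ↔ R ⊆ S := by
        rw [Finset.subset_insert_iff_of_notMem ha]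
      rw [e, Finset.card_insert_of_notMem haS]
      simp only [hi]
      split_ifs <;> ring
  · intro S _ _ h
    simp at h

/-- Every subspace has a linear projection onto it. -/
theorem Submodule.exists_projection {k W : Type*} [Field k] [AddCommMonoid W] [Module k W]
    (U : Submodule k W) : ∃ q : W →ₗ[k] U, ∀ x : U, q x = x := by
  let _ : AddCommGroup W := Module.addCommMonoidToAddCommGroup k
  obtain ⟨q, hq⟩ := U.subtype.exists_leftInverse_of_injective U.ker_subtype
  exact ⟨q, fun x => LinearMap.congr_fun hq x⟩

/-- Polarization: a symmetrized value of a multilinear map lies in every submodule containing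
the values on the diagonal. -/
theorem MultilinearMap.sum_perm_mem_of_apply_const_mem {k V W ι : Type*} [CommRing k]
    [Fintype ι] [DecidableEq ι]
    [AddCommMonoid V] [Module k V] [AddCommMonoid W] [Module k W]
    (N : MultilinearMap k (fun _ : ι => V) W) (P : Submodule k W)
    (h : ∀ x, N (fun _ => x) ∈ P) (m : ι → V) :
    ∑ σ : Equiv.Perm ι, N (fun i => m (σ i)) ∈ P := by
  let _ : AddCommGroup W := Module.addCommMonoidToAddCommGroup k
  have key : ∑ S : Finset ι, (-1 : ℤ) ^ S.card • N (fun _ => ∑ j ∈ S, m j) =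
      (-1 : ℤ) ^ Fintype.card ι • ∑ σ : Equiv.Perm ι, N (fun i => m (σ i)) := by
    have h1 (S : Finset ι) : N (fun _ => ∑ j ∈ S, m j) =
        ∑ f : ι → ι, if Finset.univ.image f ⊆ S then N (fun i => m (f i)) else 0 := by
      rw [N.map_sum_finset (fun _ j => m j) fun _ => S, ← Finset.sum_filter]
      refine Finset.sum_congr ?_ fun _ _ => rfl
      ext f
      simp [Finset.image_subset_iff]
    simp_rw [h1, Finset.smul_sum, smul_ite, smul_zero]
    rw [Finset.sum_comm]
    have h2 (f : ι → ι) : (∑ S : Finset ι, if Finset.univ.image f ⊆ S then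
        (-1 : ℤ) ^ S.card • N (fun i => m (f i)) else 0) =
        if Function.Bijective f then (-1 : ℤ) ^ Fintype.card ι • N (fun i => m (f i)) else 0 := by
      have e : (∑ S : Finset ι, if Finset.univ.image f ⊆ S then
          (-1 : ℤ) ^ S.card • N (fun i => m (f i)) else 0) =
          (∑ S : Finset ι, if Finset.univ.image f ⊆ S then (-1 : ℤ) ^ S.card else 0) •
            N (fun i => m (f i)) := by
        rw [Finset.sum_smul]
        simp only [ite_smul, zero_smul]
      rw [e]
      by_cases hf : Function.Bijective f
      · rw [Finset.image_univ_of_surjective hf.2, if_pos hf]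
        simp [Finset.univ_subset_iff]
      · rw [Finset.sum_superset_neg_one_pow_card, zero_smul, if_neg hf]
        intro hu
        apply hf
        rw [← Finite.surjective_iff_bijective]
        intro j
        have hj : j ∈ Finset.univ.image f := by rw [hu]; exact Finset.mem_univ j
        simpa using hj
    simp_rw [h2]
    rw [← Finset.sum_filter]
    symm
    refine Finset.sum_nbij (fun σ => ⇑σ) (by simp) ?_ ?_ (fun _ _ => rfl)
    · exact DFunLike.coe_injective.injOn
    · intro f hf
      exact ⟨Equiv.ofBijective f (by simpa using hf), by simp, rfl⟩
  have hm : (-1 : ℤ) ^ Fintype.card ι • ∑ σ : Equiv.Perm ι, N (fun i => m (σ i)) ∈ P := by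
    rw [← key]
    exact P.sum_mem fun S _ => P.toAddSubgroup.zsmul_mem (h _) _
  have := P.toAddSubgroup.zsmul_mem hm ((-1 : ℤ) ^ Fintype.card ι)
  rwa [smul_smul, ← mul_pow, neg_one_mul, neg_neg, one_pow, one_smul] at this

section TensorPower

open PiTensorProduct Module

variable {k : Type*} [Field k] {r n : ℕ}

theorem permAct_tprod (σ : Equiv.Perm (Fin n)) (w : Fin n → Fin r → k) :
    permAct k σ (tprod k w) = tprod k fun i => w (σ.symm i) := by
  simp only [permAct, LinearEquiv.coe_coe]
  exact reindex_tprod σ w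

theorem diagAct_tprod (g : Matrix (Fin r) (Fin r) k) (w : Fin n → Fin r → k) :
    diagAct k g (tprod k w) = tprod k fun i => g.mulVec (w i) := by
  simp [diagAct]

theorem permAct_comp (σ τ : Equiv.Perm (Fin n)) :
    permAct k (r := r) σ ∘ₗ permAct k τ = permAct k (σ * τ) := by
  refine PiTensorProduct.ext (MultilinearMap.ext fun w => ?_)
  simp only [LinearMap.compMultilinearMap_apply, LinearMap.comp_apply, permAct_tprod]
  rfl

theorem permAct_one : permAct k (r := r) (1 : Equiv.Perm (Fin n)) = LinearMap.id := by
  refine PiTensorProduct.ext (MultilinearMap.ext fun w => ?_)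
  simp only [LinearMap.compMultilinearMap_apply, permAct_tprod]
  rfl

theorem permAct_mul_apply (σ τ : Equiv.Perm (Fin n))
    (x : PiTensorProduct k fun _ : Fin n => Fin r → k) :
    permAct k (σ * τ) x = permAct k σ (permAct k τ x) := by
  rw [← permAct_comp, LinearMap.comp_apply]

theorem diagAct_one : diagAct k (n := n) (1 : Matrix (Fin r) (Fin r) k) = LinearMap.id := by
  simp [diagAct, Matrix.mulVecLin_one]

theorem diagAct_permAct (g : Matrix (Fin r) (Fin r) k) (σ : Equiv.Perm (Fin n))
    (x : PiTensorProduct k fun _ : Fin n => Fin r → k) :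
    diagAct k g (permAct k σ x) = permAct k σ (diagAct k g x) := by
  rw [← LinearMap.comp_apply, ← LinearMap.comp_apply]
  congr 1
  refine PiTensorProduct.ext (MultilinearMap.ext fun w => ?_)
  simp only [LinearMap.compMultilinearMap_apply, LinearMap.comp_apply, permAct_tprod,
    diagAct_tprod]

/-- Conjugating a tensor product of endomorphisms by a permutation permutes its factors. -/
theorem permAct_map_permAct_inv (σ : Equiv.Perm (Fin n))
    (M : Fin n → (Fin r → k) →ₗ[k] (Fin r → k)) :
    permAct k σ ∘ₗ PiTensorProduct.map M ∘ₗ permAct k σ⁻¹ =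
      PiTensorProduct.map fun i => M (σ⁻¹ i) := by
  refine PiTensorProduct.ext (MultilinearMap.ext fun w => ?_)
  simp only [LinearMap.compMultilinearMap_apply, LinearMap.comp_apply, permAct_tprod,
    PiTensorProduct.map_tprod]
  congr 1
  ext i
  simp [Equiv.Perm.inv_def]

theorem span_range_map_eq_top :
    Submodule.span k (Set.range fun M : Fin n → (Fin r → k) →ₗ[k] (Fin r → k) =>
      PiTensorProduct.map M) = ⊤ := by
  classical
  rw [eq_top_iff]
  intro φ _
  let b := Basis.piTensorProduct fun _ : Fin n => Pi.basisFun k (Fin r)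
  have h1 : φ = ∑ q, (b.coord q).smulRight (φ (b q)) := by
    apply LinearMap.ext
    intro x
    conv_lhs => rw [← b.sum_repr x]
    simp only [map_sum, map_smul, LinearMap.sum_apply, LinearMap.smulRight_apply,
      Basis.coord_apply]
  rw [h1]
  refine Submodule.sum_mem _ fun q _ => ?_
  have h2 (y : PiTensorProduct k fun _ : Fin n => Fin r → k) :
      y ∈ (Submodule.span k (Set.range fun M : Fin n → (Fin r → k) →ₗ[k] (Fin r → k) =>
        PiTensorProduct.map M)).comap (LinearMap.smulRightₗ (b.coord q)) := by
    have hy : y ∈ Submodule.span k (Set.range (PiTensorProduct.tprod k)) := by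
      rw [span_tprod_eq_top]; trivial
    refine Submodule.span_le.2 ?_ hy
    rintro _ ⟨w, rfl⟩
    refine Submodule.subset_span ⟨fun i => (LinearMap.proj (q i)).smulRight (w i), ?_⟩
    refine PiTensorProduct.ext (MultilinearMap.ext fun u => ?_)
    simp [b, MultilinearMap.map_smul_univ]
  exact h2 _

/-- The powers `M^{⊗n}` of arbitrary matrices are linear combinations of those of
invertible matrices. -/
theorem diagAct_mem_span_units [CharZero k] (M : Matrix (Fin r) (Fin r) k) :
    diagAct k (n := n) M ∈
      Submodule.span k (Set.range fun g : (Matrix (Fin r) (Fin r) k)ˣ => diagAct k g.1) := by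
  refine MultilinearMap.apply_const_mem_of_infinite
    (PiTensorProduct.mapMultilinear k (fun _ : Fin n => Fin r → k) fun _ => Fin r → k)
    _ M.mulVecLin LinearMap.id (S := {t | M.charpoly.eval (-t) ≠ 0}) ?_ ?_
  · have hfin : {t : k | M.charpoly.eval (-t) = 0}.Finite := by
      refine ((M.charpoly.rootSet_finite k).preimage (f := Neg.neg) neg_injective.injOn).subset ?_
      intro t ht
      simpa [Polynomial.mem_rootSet, M.charpoly_monic.ne_zero] using ht
    exact hfin.infinite_compl
  · intro t ht
    have hu : IsUnit (M + Matrix.scalar (Fin r) t) := by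
      rw [Matrix.isUnit_iff_isUnit_det, isUnit_iff_ne_zero]
      intro h0
      apply ht
      rw [Matrix.eval_charpoly]
      have : Matrix.scalar (Fin r) (-t) - M = -(M + Matrix.scalar (Fin r) t) := by
        rw [map_neg]; abel
      rw [this, Matrix.det_neg, h0]; simp
    refine Submodule.subset_span ⟨hu.unit, ?_⟩
    have e : (M + Matrix.scalar (Fin r) t).mulVecLin = M.mulVecLin + t • LinearMap.id := by
      rw [Matrix.mulVecLin_add]
      congr 1
      apply LinearMap.ext
      intro x
      ext i
      simp [Matrix.mulVec_diagonal]
    simp only [diagAct, IsUnit.unit_spec, e]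
    rfl

/-- The double commutant half of Schur–Weyl duality: endomorphisms of `(k^r)^{⊗n}` commuting
with `S_n` lie in the span of the image of `GL_r(k)`. -/
theorem mem_span_diagAct_of_comm_permAct [CharZero k]
    (φ : (PiTensorProduct k fun _ : Fin n => Fin r → k) →ₗ[k]
      PiTensorProduct k fun _ : Fin n => Fin r → k)
    (hφ : ∀ (σ : Equiv.Perm (Fin n)) x, φ (permAct k σ x) = permAct k σ (φ x)) :
    φ ∈ Submodule.span k
      (Set.range fun g : (Matrix (Fin r) (Fin r) k)ˣ => diagAct k (n := n) g.1) := by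
  set P := Submodule.span k
    (Set.range fun g : (Matrix (Fin r) (Fin r) k)ˣ => diagAct k (n := n) g.1)
  have hav (ψ : (PiTensorProduct k fun _ : Fin n => Fin r → k) →ₗ[k]
      PiTensorProduct k fun _ : Fin n => Fin r → k) :
      ∑ σ : Equiv.Perm (Fin n), permAct k σ ∘ₗ ψ ∘ₗ permAct k σ⁻¹ ∈ P := by
    have hψ : ψ ∈ Submodule.span k (Set.range fun M : Fin n → (Fin r → k) →ₗ[k] (Fin r → k) =>
        PiTensorProduct.map M) := by rw [span_range_map_eq_top]; trivial
    induction hψ using Submodule.span_induction with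
    | mem x hx =>
      obtain ⟨M, rfl⟩ := hx
      simp_rw [permAct_map_permAct_inv]
      rw [← Equiv.sum_comp (Equiv.inv (Equiv.Perm (Fin n)))]
      simp only [Equiv.inv_apply, inv_inv]
      refine MultilinearMap.sum_perm_mem_of_apply_const_mem
        (PiTensorProduct.mapMultilinear k (fun _ : Fin n => Fin r → k) fun _ => Fin r → k)
        P (fun x => ?_) M
      have := diagAct_mem_span_units (n := n) (LinearMap.toMatrix' x)
      have e : (LinearMap.toMatrix' x).mulVecLin = x := by
        rw [← Matrix.toLin'_apply', Matrix.toLin'_toMatrix']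
      rw [diagAct, e] at this
      exact this
    | zero => simp
    | add x y _ _ hx hy =>
      simp only [LinearMap.add_comp, LinearMap.comp_add, Finset.sum_add_distrib]
      exact P.add_mem hx hy
    | smul c x _ hx =>
      simp only [LinearMap.smul_comp, LinearMap.comp_smul, ← Finset.smul_sum]
      exact P.smul_mem c hx
  have h1 : ∑ σ : Equiv.Perm (Fin n), permAct k σ ∘ₗ φ ∘ₗ permAct k σ⁻¹ =
      (Fintype.card (Equiv.Perm (Fin n)) : k) • φ := by
    have (σ : Equiv.Perm (Fin n)) : permAct k σ ∘ₗ φ ∘ₗ permAct k σ⁻¹ = φ := by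
      apply LinearMap.ext
      intro x
      simp only [LinearMap.comp_apply]
      rw [← hφ, ← permAct_mul_apply, mul_inv_cancel, permAct_one, LinearMap.id_apply]
    simp [this, Nat.cast_smul_eq_nsmul]
  have h2 := P.smul_mem (Fintype.card (Equiv.Perm (Fin n)) : k)⁻¹ (h1 ▸ hav φ)
  rwa [smul_smul, inv_mul_cancel₀ (Nat.cast_ne_zero.2 Fintype.card_ne_zero), one_smul] at h2

/-- Maschke's theorem: an `S_n`-stable subspace of `(k^r)^{⊗n}` has an equivariant projection. -/
theorem exists_permAct_equivariant_projection [CharZero k]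
    (U : Submodule k (PiTensorProduct k fun _ : Fin n => Fin r → k))
    (hU : ∀ σ, ∀ x ∈ U, permAct k σ x ∈ U) :
    ∃ p : (PiTensorProduct k fun _ : Fin n => Fin r → k) →ₗ[k] U,
      (∀ x : U, p x = x) ∧ ∀ σ x, (p (permAct k σ x)).1 = permAct k σ (p x).1 := by
  obtain ⟨q, hq⟩ := U.exists_projection
  have hq' (x) (hx : x ∈ U) : (q x).1 = x := congrArg Subtype.val (hq ⟨x, hx⟩)
  let c : k := (Fintype.card (Equiv.Perm (Fin n)) : k)
  have hc : c ≠ 0 := Nat.cast_ne_zero.2 Fintype.card_ne_zero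
  let p₀ : (PiTensorProduct k fun _ : Fin n => Fin r → k) →ₗ[k]
      PiTensorProduct k fun _ : Fin n => Fin r → k :=
    c⁻¹ • ∑ σ : Equiv.Perm (Fin n), permAct k σ ∘ₗ (U.subtype ∘ₗ q) ∘ₗ permAct k σ⁻¹
  have hp₀ (x) : p₀ x = c⁻¹ • ∑ σ : Equiv.Perm (Fin n),
      permAct k σ (q (permAct k σ⁻¹ x)).1 := by
    simp [p₀]
  refine ⟨p₀.codRestrict U fun x => ?_, fun x => ?_, fun τ x => ?_⟩
  · rw [hp₀]
    exact U.smul_mem _ (U.sum_mem fun σ _ => hU σ _ (q _).2)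
  · ext1
    rw [LinearMap.codRestrict_apply, hp₀]
    have (σ : Equiv.Perm (Fin n)) : permAct k σ (q (permAct k σ⁻¹ x.1)).1 = x.1 := by
      rw [hq' _ (hU _ _ x.2), ← permAct_mul_apply, mul_inv_cancel, permAct_one,
        LinearMap.id_apply]
    simp_rw [this]
    rw [Finset.sum_const, Finset.card_univ, ← Nat.cast_smul_eq_nsmul k, smul_smul,
      inv_mul_cancel₀ hc, one_smul]
  · simp only [LinearMap.codRestrict_apply, hp₀, map_smul, map_sum]
    congr 1
    rw [← Equiv.sum_comp (Equiv.mulLeft τ)]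
    refine Finset.sum_congr rfl fun σ _ => ?_
    simp only [Equiv.coe_mulLeft, mul_inv_rev, permAct_mul_apply]
    rw [← permAct_mul_apply τ⁻¹, inv_mul_cancel, permAct_one, LinearMap.id_apply]

variable (v : Matrix (Fin r) (Fin n) k)

theorem vtens_mem_tensMod : vtens k v ∈ tensMod k v :=
  Submodule.subset_span ⟨1, by simp [diagAct_one]⟩

theorem vtens_mem_symMod : vtens k v ∈ symMod k v :=
  Submodule.subset_span ⟨1, by simp [permAct_one]⟩

theorem permAct_mem_symMod (σ : Equiv.Perm (Fin n)) :
    ∀ x ∈ symMod k v, permAct k σ x ∈ symMod k v := by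
  suffices symMod k v ≤ (symMod k v).comap (permAct k σ) from this
  refine Submodule.span_le.2 ?_
  rintro _ ⟨τ, rfl⟩
  exact Submodule.subset_span ⟨σ * τ, (permAct_mul_apply _ _ _).symm⟩

theorem apply_vtens_mem_tensMod
    {φ : (PiTensorProduct k fun _ : Fin n => Fin r → k) →ₗ[k]
      PiTensorProduct k fun _ : Fin n => Fin r → k}
    (hφ : φ ∈ Submodule.span k
      (Set.range fun g : (Matrix (Fin r) (Fin r) k)ˣ => diagAct k (n := n) g.1)) :
    φ (vtens k v) ∈ tensMod k v := by
  suffices Submodule.span k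
      (Set.range fun g : (Matrix (Fin r) (Fin r) k)ˣ => diagAct k (n := n) g.1) ≤
      (tensMod k v).comap (LinearMap.applyₗ (vtens k v)) from this hφ
  refine Submodule.span_le.2 ?_
  rintro _ ⟨g, rfl⟩
  exact Submodule.subset_span ⟨g, rfl⟩

/-- A `GL_r`-equivariant map on `G(v)` commutes with the enveloping algebra of `GL_r`. -/
theorem homGL_apply_of_mem_span {f} (hf : f ∈ homGL k v)
    {φ : (PiTensorProduct k fun _ : Fin n => Fin r → k) →ₗ[k]
      PiTensorProduct k fun _ : Fin n => Fin r → k}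
    (hφ : φ ∈ Submodule.span k
      (Set.range fun g : (Matrix (Fin r) (Fin r) k)ˣ => diagAct k (n := n) g.1)) :
    f ⟨φ (vtens k v), apply_vtens_mem_tensMod v hφ⟩ =
      φ (f ⟨vtens k v, vtens_mem_tensMod v⟩) := by
  induction hφ using Submodule.span_induction with
  | mem x hx =>
    obtain ⟨g, rfl⟩ := hx
    exact hf g _ _ rfl
  | zero => exact map_zero f
  | add x y hx hy ihx ihy =>
    exact (map_add f ⟨_, apply_vtens_mem_tensMod v hx⟩ ⟨_, apply_vtens_mem_tensMod v hy⟩).trans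
      (congrArg₂ _ ihx ihy)
  | smul c x hx ihx =>
    exact (map_smul f c ⟨_, apply_vtens_mem_tensMod v hx⟩).trans
      (congrArg _ ihx)

theorem homGL_apply_vtens_mem [CharZero k] {f} (hf : f ∈ homGL k v) :
    f ⟨vtens k v, vtens_mem_tensMod v⟩ ∈ symMod k v := by
  obtain ⟨p, hp, hpc⟩ := exists_permAct_equivariant_projection _ (permAct_mem_symMod v)
  have hmem := mem_span_diagAct_of_comm_permAct ((symMod k v).subtype ∘ₗ p) hpc
  have h := homGL_apply_of_mem_span v hf hmem
  have e : ((symMod k v).subtype ∘ₗ p) (vtens k v) = vtens k v :=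
    congrArg Subtype.val (hp ⟨_, vtens_mem_symMod v⟩)
  simp only [e] at h
  rw [h]
  exact (p _).2

theorem homSn_apply_vtens_mem [CharZero k] {f} (hf : f ∈ homSn k v) :
    f ⟨vtens k v, vtens_mem_symMod v⟩ ∈ tensMod k v := by
  obtain ⟨p, hp, hpc⟩ := exists_permAct_equivariant_projection _ (permAct_mem_symMod v)
  have hmem := mem_span_diagAct_of_comm_permAct (f ∘ₗ p) fun σ x => hf σ _ _ (hpc σ x)
  have h := apply_vtens_mem_tensMod v hmem
  rwa [LinearMap.comp_apply, hp ⟨_, vtens_mem_symMod v⟩] at h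

theorem homGL_ext {f f'} (hf : f ∈ homGL k v) (hf' : f' ∈ homGL k v)
    (h0 : f ⟨vtens k v, vtens_mem_tensMod v⟩ = f' ⟨vtens k v, vtens_mem_tensMod v⟩) : f = f' := by
  apply LinearMap.ext
  rintro ⟨x, hx⟩
  have key : ∀ y (hy : y ∈ tensMod k v), f ⟨y, hy⟩ = f' ⟨y, hy⟩ := by
    intro y hy
    induction hy using Submodule.span_induction with
    | mem x hx =>
      obtain ⟨g, rfl⟩ := hx
      exact (hf g ⟨vtens k v, vtens_mem_tensMod v⟩ ⟨_, _⟩ rfl).trans ((congrArg _ h0).trans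
        (hf' g ⟨vtens k v, vtens_mem_tensMod v⟩ ⟨_, _⟩ rfl).symm)
    | zero => exact (map_zero f).trans (map_zero f').symm
    | add x y hx hy ihx ihy =>
      exact (map_add f ⟨x, hx⟩ ⟨y, hy⟩).trans
        ((congrArg₂ _ ihx ihy).trans (map_add f' ⟨x, hx⟩ ⟨y, hy⟩).symm)
    | smul c x hx ihx =>
      exact (map_smul f c ⟨x, hx⟩).trans
        ((congrArg _ ihx).trans (map_smul f' c ⟨x, hx⟩).symm)
  exact key x hx

theorem homSn_ext {f f'} (hf : f ∈ homSn k v) (hf' : f' ∈ homSn k v)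
    (h0 : f ⟨vtens k v, vtens_mem_symMod v⟩ = f' ⟨vtens k v, vtens_mem_symMod v⟩) : f = f' := by
  apply LinearMap.ext
  rintro ⟨x, hx⟩
  have key : ∀ y (hy : y ∈ symMod k v), f ⟨y, hy⟩ = f' ⟨y, hy⟩ := by
    intro y hy
    induction hy using Submodule.span_induction with
    | mem x hx =>
      obtain ⟨g, rfl⟩ := hx
      exact (hf g ⟨vtens k v, vtens_mem_symMod v⟩ ⟨_, _⟩ rfl).trans ((congrArg _ h0).trans
        (hf' g ⟨vtens k v, vtens_mem_symMod v⟩ ⟨_, _⟩ rfl).symm)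
    | zero => exact (map_zero f).trans (map_zero f').symm
    | add x y hx hy ihx ihy =>
      exact (map_add f ⟨x, hx⟩ ⟨y, hy⟩).trans
        ((congrArg₂ _ ihx ihy).trans (map_add f' ⟨x, hx⟩ ⟨y, hy⟩).symm)
    | smul c x hx ihx =>
      exact (map_smul f c ⟨x, hx⟩).trans
        ((congrArg _ ihx).trans (map_smul f' c ⟨x, hx⟩).symm)
  exact key x hx

theorem exists_homGL_apply_vtens_eq {y} (hy : y ∈ symMod k v) :
    ∃ f ∈ homGL k v, f ⟨vtens k v, vtens_mem_tensMod v⟩ = y := by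
  suffices symMod k v ≤ (homGL k v).map (LinearMap.applyₗ ⟨vtens k v, vtens_mem_tensMod v⟩) from
    this hy
  refine Submodule.span_le.2 ?_
  rintro _ ⟨σ, rfl⟩
  refine ⟨permAct k σ ∘ₗ (tensMod k v).subtype, fun g x y hxy => ?_, rfl⟩
  simp only [LinearMap.comp_apply, Submodule.subtype_apply, hxy, diagAct_permAct]

theorem exists_homSn_apply_vtens_eq {y} (hy : y ∈ tensMod k v) :
    ∃ f ∈ homSn k v, f ⟨vtens k v, vtens_mem_symMod v⟩ = y := by
  suffices tensMod k v ≤ (homSn k v).map (LinearMap.applyₗ ⟨vtens k v, vtens_mem_symMod v⟩) from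
    this hy
  refine Submodule.span_le.2 ?_
  rintro _ ⟨g, rfl⟩
  refine ⟨diagAct k g.1 ∘ₗ (symMod k v).subtype, fun σ x y hxy => ?_, rfl⟩
  simp only [LinearMap.comp_apply, Submodule.subtype_apply, hxy, diagAct_permAct]

end TensorPower

/-- Schur–Weyl duality for `G(v)` and `𝔖(v)`: evaluation at `v^⊗` is a `k`-linear
isomorphism `Hom_{GL_r(k)}(G(v), (k^r)^{⊗n}) ≃ 𝔖(v)` intertwining the `S_n`-actions,
and a `k`-linear isomorphism `Hom_{S_n}(𝔖(v), (k^r)^{⊗n}) ≃ G(v)` intertwining the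
`GL_r(k)`-actions. -/
theorem schur_weyl_duality_for_tensor_modules
    {k : Type*} [Field k] [CharZero k] {r n : ℕ}
    (v : Matrix (Fin r) (Fin n) k) :
    (∃ Φ : ↥(homGL k v) ≃ₗ[k] ↥(symMod k v),
      (∀ f : ↥(homGL k v), ∀ x : ↥(tensMod k v),
        x.1 = vtens k v → (Φ f).1 = f.1 x) ∧
      (∀ σ : Equiv.Perm (Fin n), ∀ f f' : ↥(homGL k v),
        (∀ x, f'.1 x = permAct k σ (f.1 x)) → (Φ f').1 = permAct k σ (Φ f).1)) ∧
    (∃ Ψ : ↥(homSn k v) ≃ₗ[k] ↥(tensMod k v),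
      (∀ f : ↥(homSn k v), ∀ x : ↥(symMod k v),
        x.1 = vtens k v → (Ψ f).1 = f.1 x) ∧
      (∀ g : (Matrix (Fin r) (Fin r) k)ˣ, ∀ f f' : ↥(homSn k v),
        (∀ x, f'.1 x = diagAct k g.1 (f.1 x)) → (Ψ f').1 = diagAct k g.1 (Ψ f).1)) := by
  constructor
  · let e : ↥(homGL k v) →ₗ[k] ↥(symMod k v) :=
      ((LinearMap.applyₗ (⟨vtens k v, vtens_mem_tensMod v⟩ : ↥(tensMod k v))).domRestrict
        (homGL k v)).codRestrict
        (symMod k v) fun f => homGL_apply_vtens_mem v f.2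
    have he : Function.Bijective e := by
      constructor
      · intro f f' h
        exact Subtype.ext (homGL_ext v f.2 f'.2 (congrArg Subtype.val h))
      · rintro ⟨y, hy⟩
        obtain ⟨f, hf, rfl⟩ := exists_homGL_apply_vtens_eq v hy
        exact ⟨⟨f, hf⟩, rfl⟩
    refine ⟨LinearEquiv.ofBijective e he, fun f x hx => ?_, fun σ f f' h => h _⟩
    obtain rfl : x = ⟨vtens k v, vtens_mem_tensMod v⟩ := Subtype.ext hx
    rfl
  · let e : ↥(homSn k v) →ₗ[k] ↥(tensMod k v) :=
      ((LinearMap.applyₗ (⟨vtens k v, vtens_mem_symMod v⟩ : ↥(symMod k v))).domRestrict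
        (homSn k v)).codRestrict
        (tensMod k v) fun f => homSn_apply_vtens_mem v f.2
    have he : Function.Bijective e := by
      constructor
      · intro f f' h
        exact Subtype.ext (homSn_ext v f.2 f'.2 (congrArg Subtype.val h))
      · rintro ⟨y, hy⟩
        obtain ⟨f, hf, rfl⟩ := exists_homSn_apply_vtens_eq v hy
        exact ⟨⟨f, hf⟩, rfl⟩
    refine ⟨LinearEquiv.ofBijective e he, fun f x hx => ?_, fun g f f' h => h _⟩
    obtain rfl : x = ⟨vtens k v, vtens_mem_symMod v⟩ := Subtype.ext hx
    rfl
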